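/- For every real t ≥ 1, with x(t) := (1/2)·(1 − E6(it)/E4(it)^{3/2}) ∈ [0, 1/2], the logarithmic derivative of the Gauss hypergeometric function satisfies x(t)·₂F₁'(1/6, 5/6; 1; x(t)) = E4(it)^{1/4}·(E2(it)·E4(it) − E6(it)) / (6·(E4(it)^{3/2} + E6(it))), where ₂F₁'(α, β; 1; x) denotes the derivative of x ↦ ₂F₁(α, β; 1; x), and E4(it)^{3/2}, E4(it)^{1/4} denote the positive real powers of the positive real number E4(it). -/

import Mathlib

/-- The nome `q = e^{2πi(it)} = e^{−2πt}` for `τ = it`. -/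
noncomputable def nome (t : ℝ) : ℝ := Real.exp (-2 * Real.pi * t)

/-- `E2(it) = 1 − 24·Σ_{n≥1} σ₁(n) q^n`. -/
noncomputable def E2val (t : ℝ) : ℝ :=
  1 - 24 * ∑' n : ℕ, (∑ d ∈ Nat.divisors (n + 1), (d : ℝ) ^ 1) * nome t ^ (n + 1)

/-- `E4(it) = 1 + 240·Σ_{n≥1} σ₃(n) q^n`. -/
noncomputable def E4val (t : ℝ) : ℝ :=
  1 + 240 * ∑' n : ℕ, (∑ d ∈ Nat.divisors (n + 1), (d : ℝ) ^ 3) * nome t ^ (n + 1)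

/-- `E6(it) = 1 − 504·Σ_{n≥1} σ₅(n) q^n`. -/
noncomputable def E6val (t : ℝ) : ℝ :=
  1 - 504 * ∑' n : ℕ, (∑ d ∈ Nat.divisors (n + 1), (d : ℝ) ^ 5) * nome t ^ (n + 1)

/-- `x(t) = (1/2)(1 − E6(it)/E4(it)^{3/2})`, with the positive real power. -/
noncomputable def xval (t : ℝ) : ℝ :=
  (1 / 2) * (1 - E6val t / E4val t ^ ((3 : ℝ) / 2))

/-- The Gauss hypergeometric series `₂F₁(α, β; 1; x)`. -/
noncomputable def gauss2F1 (α β : ℝ) (x : ℝ) : ℝ :=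
  ∑' k : ℕ,
    ((ascPochhammer ℝ k).eval α * (ascPochhammer ℝ k).eval β / ((k.factorial : ℝ)) ^ 2) * x ^ k

section Ramanujan

open UpperHalfPlane hiding I
open Complex Derivative EisensteinSeries ModularForm Filter Topology Function
open scoped MatrixGroups Manifold CongruenceSubgroup

theorem hasFPowerSeriesOnBall_cuspFunction_of_hasSum {f : ℍ → ℂ} {c : ℕ → ℂ} (hol : MDiff f)
    (hf : ∀ τ : ℍ, HasSum (fun m ↦ c m • Periodic.qParam 1 τ ^ m) (f τ)) :
    HasFPowerSeriesOnBall (cuspFunction 1 f) (.ofScalars ℂ c) 0 1 ∧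
      ∀ τ : ℍ, f τ = cuspFunction 1 f (Periodic.qParam 1 τ) := by
  have hper : Periodic (f ∘ ofComplex) ((1 : ℝ) : ℂ) := by
    intro z
    rcases lt_or_ge 0 z.im with hz | hz
    · have hz' : 0 < (z + (1 : ℝ)).im := by simpa using hz
      simp only [comp_apply, ofComplex_apply_of_im_pos hz, ofComplex_apply_of_im_pos hz']
      have h1 := hf ⟨z + (1 : ℝ), hz'⟩
      have h2 := hf ⟨z, hz⟩
      have : Periodic.qParam 1 (z + (1 : ℝ)) = Periodic.qParam 1 z := by
        simp [Periodic.qParam, mul_add, Complex.exp_add, Complex.exp_two_pi_mul_I]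
      simp only [this] at h1
      exact h1.unique h2
    · have hz' : (z + (1 : ℝ)).im ≤ 0 := by simpa using hz
      simp only [comp_apply, ofComplex_apply_of_im_nonpos hz, ofComplex_apply_of_im_nonpos hz']
  exact ⟨hasFPowerSeriesOnBall_cuspFunction one_pos (analyticAt_cuspFunction_zero one_pos hper hol
    (isBoundedAtImInfty_of_hasSum_qExpansion one_pos hf)) hf,
    fun τ ↦ (eq_cuspFunction τ one_ne_zero hper).symm⟩

theorem tendsto_atImInfty_of_hasSum {f : ℍ → ℂ} {c : ℕ → ℂ} (hol : MDiff f)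
    (hf : ∀ τ : ℍ, HasSum (fun m ↦ c m • Periodic.qParam 1 τ ^ m) (f τ)) :
    Tendsto f atImInfty (𝓝 (c 0)) := by
  obtain ⟨hP, hval⟩ := hasFPowerSeriesOnBall_cuspFunction_of_hasSum hol hf
  have h0 : cuspFunction 1 f 0 = c 0 := by
    simpa using (hP.coeff_zero (fun i ↦ i.elim0)).symm
  rw [← h0]
  exact (hP.analyticAt.continuousAt.tendsto.comp (qParam_tendsto_atImInfty one_pos)).congr
    fun τ ↦ (hval τ).symm

theorem normalizedDerivOfComplex_eq_qParam_mul_deriv {f : ℍ → ℂ} {c : ℕ → ℂ} (hol : MDiff f)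
    (hf : ∀ τ : ℍ, HasSum (fun m ↦ c m • Periodic.qParam 1 τ ^ m) (f τ)) (τ : ℍ) :
    normalizedDerivOfComplex f τ =
      Periodic.qParam 1 τ * deriv (cuspFunction 1 f) (Periodic.qParam 1 τ) := by
  obtain ⟨hP, hval⟩ := hasFPowerSeriesOnBall_cuspFunction_of_hasSum hol hf
  have hd : DifferentiableAt ℂ (cuspFunction 1 f) (Periodic.qParam 1 τ) :=
    hP.differentiableOn.differentiableAt (Metric.isOpen_eball.mem_nhds (by
      simpa [← ofReal_norm] using Periodic.norm_qParam_lt_one one_pos τ.im_pos))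
  have hqd : HasDerivAt (fun z : ℂ ↦ Periodic.qParam 1 z)
      (2 * Real.pi * I * Periodic.qParam 1 τ) τ := by
    have : HasDerivAt (fun z : ℂ ↦ 2 * Real.pi * I * z / (1 : ℝ)) (2 * Real.pi * I) τ := by
      simpa using (hasDerivAt_id (τ : ℂ)).const_mul (2 * Real.pi * I)
    simpa [Periodic.qParam, mul_comm] using this.cexp
  have hev : f ∘ ofComplex =ᶠ[𝓝 (τ : ℂ)] cuspFunction 1 f ∘ fun z : ℂ ↦ Periodic.qParam 1 z := by
    filter_upwards [isOpen_upperHalfPlaneSet.mem_nhds τ.im_pos] with z hz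
    simpa [ofComplex_apply_of_im_pos hz] using hval ⟨z, hz⟩
  rw [normalizedDerivOfComplex,
    ((hd.hasDerivAt.comp (τ : ℂ) hqd).congr_of_eventuallyEq hev).deriv]
  field_simp [Complex.two_pi_I_ne_zero]

theorem tendsto_normalizedDerivOfComplex_atImInfty_of_hasSum {f : ℍ → ℂ} {c : ℕ → ℂ}
    (hol : MDiff f) (hf : ∀ τ : ℍ, HasSum (fun m ↦ c m • Periodic.qParam 1 τ ^ m) (f τ)) :
    Tendsto (normalizedDerivOfComplex f) atImInfty (𝓝 0) := by
  have hP := (hasFPowerSeriesOnBall_cuspFunction_of_hasSum hol hf).1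
  have := (continuousAt_id.mul hP.analyticAt.deriv.continuousAt).tendsto.comp
    (qParam_tendsto_atImInfty one_pos)
  simpa using this.congr fun τ ↦ (normalizedDerivOfComplex_eq_qParam_mul_deriv hol hf τ).symm

theorem eq_zero_of_slash_invariant_of_weight_lt_twelve {k : ℤ} (hk : k < 12) {f : ℍ → ℂ}
    (hf : ∀ γ : SL(2, ℤ), f ∣[k] γ = f) (hol : MDiff f) (h0 : Tendsto f atImInfty (𝓝 0)) :
    f = 0 := by
  let F : CuspForm 𝒮ℒ k :=
    { toFun := f
      slash_action_eq' := by
        rintro _ ⟨A, rfl⟩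
        exact hf A
      holo' := hol
      zero_at_cusps' := fun hc ↦ by
        rw [Subgroup.IsArithmetic.isCusp_iff_isCusp_SL2Z] at hc
        rw [OnePoint.isZeroAt_iff_forall_SL2Z hc]
        intro γ _
        rw [hf]
        exact h0 }
  have hF : F = 0 := rank_zero_iff_forall_zero.mp (CuspForm.rank_eq_zero_of_weight_lt_twelve hk) F
  exact congrArg (fun G : CuspForm 𝒮ℒ k ↦ (G : ℍ → ℂ)) hF

theorem hasSum_qParam_E2 (τ : ℍ) :
    HasSum (fun m ↦ (if m = 0 then 1 else -24 * (ArithmeticFunction.sigma 1 m : ℂ)) •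
      Periodic.qParam 1 τ ^ m) (E2 τ) := by
  simpa [Periodic.qParam] using hasSum_qExpansion_E2 τ

theorem hasSum_qParam_E₄ (τ : ℍ) :
    HasSum (fun m ↦ (if m = 0 then 1 else 240 * (ArithmeticFunction.sigma 3 m : ℂ)) •
      Periodic.qParam 1 τ ^ m) (E₄ τ) := by
  have := UpperHalfPlane.hasSum_qExpansion one_pos
    (SlashInvariantFormClass.periodic_comp_ofComplex E₄ one_mem_strictPeriods_SL)
    E₄.holo' (ModularFormClass.bdd_at_infty E₄) τ
  refine this.congr_fun ?_
  intro m
  rw [E_qExpansion_coeff _ ⟨2, rfl⟩]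
  norm_num [show bernoulli 4 = -1 / 30 by decide +kernel]

theorem hasSum_qParam_E₆ (τ : ℍ) :
    HasSum (fun m ↦ (if m = 0 then 1 else -504 * (ArithmeticFunction.sigma 5 m : ℂ)) •
      Periodic.qParam 1 τ ^ m) (E₆ τ) := by
  have := UpperHalfPlane.hasSum_qExpansion one_pos
    (SlashInvariantFormClass.periodic_comp_ofComplex E₆ one_mem_strictPeriods_SL)
    E₆.holo' (ModularFormClass.bdd_at_infty E₆) τ
  refine this.congr_fun ?_
  intro m
  rw [E_qExpansion_coeff _ ⟨3, rfl⟩]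
  norm_num [show bernoulli 6 = 1 / 42 by decide +kernel]

theorem slash_eq_of_mem_SL {k : ℤ} (f : ModularForm 𝒮ℒ k) (γ : SL(2, ℤ)) :
    (f : ℍ → ℂ) ∣[k] γ = f :=
  f.slash_action_eq' _ ⟨γ, rfl⟩

theorem tendsto_E2_atImInfty : Tendsto E2 atImInfty (𝓝 1) := by
  simpa using tendsto_atImInfty_of_hasSum E2_mdifferentiable hasSum_qParam_E2

theorem tendsto_E₄_atImInfty : Tendsto E₄ atImInfty (𝓝 1) := by
  simpa using tendsto_atImInfty_of_hasSum E₄.holo' hasSum_qParam_E₄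

theorem tendsto_E₆_atImInfty : Tendsto E₆ atImInfty (𝓝 1) := by
  simpa using tendsto_atImInfty_of_hasSum E₆.holo' hasSum_qParam_E₆

theorem normalizedDerivOfComplex_E₄ (τ : ℍ) :
    normalizedDerivOfComplex E₄ τ = (E2 τ * E₄ τ - E₆ τ) / 3 := by
  have hol : MDiff (serreDerivative 4 E₄ + (3⁻¹ : ℂ) • (E₆ : ℍ → ℂ)) :=
    (serreDerivative_mdifferentiable 4 E₄.holo').add (E₆.holo'.const_smul _)
  have := eq_zero_of_slash_invariant_of_weight_lt_twelve (k := 6) (by norm_num) (fun γ ↦ ?_)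
    hol ?_
  · have := congrFun this τ
    simp at this
    linear_combination this
  · have h4 := serreDerivative_slash_invariant (γ := γ) E₄.holo' (slash_eq_of_mem_SL E₄ γ)
    have h6 := slash_eq_of_mem_SL E₆ γ
    rw [SlashAction.add_slash, ModularForm.SL_smul_slash]
    exact congrArg₂ (· + ·) (mod_cast h4) (congrArg _ h6)
  · have hD : Tendsto (normalizedDerivOfComplex E₄) atImInfty (𝓝 0) :=
      tendsto_normalizedDerivOfComplex_atImInfty_of_hasSum E₄.holo' hasSum_qParam_E₄
    have h := (hD.sub ((tendsto_E2_atImInfty.const_mul (4 * 12⁻¹)).mul tendsto_E₄_atImInfty)).add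
      (tendsto_E₆_atImInfty.const_mul (3⁻¹ : ℂ))
    norm_num at h
    refine h.congr fun z ↦ ?_
    simp only [Pi.add_apply, Pi.smul_apply, serreDerivative_apply, smul_eq_mul]
    ring

theorem normalizedDerivOfComplex_E₆ (τ : ℍ) :
    normalizedDerivOfComplex E₆ τ = (E2 τ * E₆ τ - E₄ τ ^ 2) / 2 := by
  have hol : MDiff (serreDerivative 6 E₆ + (2⁻¹ : ℂ) • ((E₄ : ℍ → ℂ) * E₄)) :=
    (serreDerivative_mdifferentiable 6 E₆.holo').add ((E₄.holo'.mul E₄.holo').const_smul _)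
  have := eq_zero_of_slash_invariant_of_weight_lt_twelve (k := 8) (by norm_num) (fun γ ↦ ?_)
    hol ?_
  · have := congrFun this τ
    simp at this
    linear_combination this
  · have h6 := serreDerivative_slash_invariant (γ := γ) E₆.holo' (slash_eq_of_mem_SL E₆ γ)
    have h4 := slash_eq_of_mem_SL E₄ γ
    have h8 := mul_slash_SL2 4 4 γ E₄ E₄
    rw [h4] at h8
    rw [SlashAction.add_slash, ModularForm.SL_smul_slash]
    exact congrArg₂ (· + ·) (mod_cast h6) (congrArg _ h8)
  · have hD : Tendsto (normalizedDerivOfComplex E₆) atImInfty (𝓝 0) :=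
      tendsto_normalizedDerivOfComplex_atImInfty_of_hasSum E₆.holo' hasSum_qParam_E₆
    have h := (hD.sub ((tendsto_E2_atImInfty.const_mul (6 * 12⁻¹)).mul tendsto_E₆_atImInfty)).add
      ((tendsto_E₄_atImInfty.mul tendsto_E₄_atImInfty).const_mul (2⁻¹ : ℂ))
    norm_num at h
    refine h.congr fun z ↦ ?_
    simp only [Pi.add_apply, Pi.smul_apply, Pi.mul_apply, serreDerivative_apply, smul_eq_mul]
    ring

theorem normalizedDerivOfComplex_const_div_denom (γ : SL(2, ℤ)) (z : ℍ) :
    normalizedDerivOfComplex (fun w ↦ (γ 1 0 : ℂ) / denom γ w) z =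
      -(2 * Real.pi * I)⁻¹ * ((γ 1 0 : ℂ) / denom γ z) ^ 2 := by
  have h := (hasDerivAt_denom_zpow (γ : GL (Fin 2) ℝ) (-1) z).const_mul (γ 1 0 : ℂ)
  have hev : (fun w : ℍ ↦ (γ 1 0 : ℂ) / denom γ w) ∘ ofComplex =ᶠ[𝓝 (z : ℂ)]
      fun w ↦ (γ 1 0 : ℂ) * denom γ w ^ (-1 : ℤ) := by
    filter_upwards [isOpen_upperHalfPlaneSet.mem_nhds z.im_pos] with w hw
    simp [ofComplex_apply_of_im_pos hw, div_eq_mul_inv]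
  rw [normalizedDerivOfComplex, (h.congr_of_eventuallyEq hev).deriv]
  have hz := denom_ne_zero γ z
  norm_num [zpow_neg]
  field_simp

theorem mdifferentiable_const_div_denom (γ : SL(2, ℤ)) :
    MDiff (fun w : ℍ ↦ (γ 1 0 : ℂ) / denom γ w) := by
  rw [UpperHalfPlane.mdifferentiable_iff]
  intro w hw
  have h := (hasDerivAt_denom_zpow (γ : GL (Fin 2) ℝ) (-1) ⟨w, hw⟩).const_mul (γ 1 0 : ℂ)
  refine (h.congr_of_eventuallyEq ?_).differentiableAt.differentiableWithinAt
  filter_upwards [isOpen_upperHalfPlaneSet.mem_nhds hw] with w hw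
  simp [ofComplex_apply_of_im_pos hw, div_eq_mul_inv]

theorem normalizedDerivOfComplex_E2 (τ : ℍ) :
    normalizedDerivOfComplex E2 τ = (E2 τ ^ 2 - E₄ τ) / 12 := by
  have hol : MDiff (normalizedDerivOfComplex E2 - (12⁻¹ : ℂ) • (E2 * E2 - (E₄ : ℍ → ℂ))) :=
    (normalizedDerivOfComplex_mdifferentiable E2_mdifferentiable).sub
      (((E2_mdifferentiable.mul E2_mdifferentiable).sub E₄.holo').const_smul _)
  have := eq_zero_of_slash_invariant_of_weight_lt_twelve (k := 4) (by norm_num) (fun γ ↦ ?_)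
    hol ?_
  · have := congrFun this τ
    simp at this
    linear_combination this
  · have hE2 : E2 ∣[(2 : ℤ)] γ = E2 - (6 * I / Real.pi) • fun w : ℍ ↦ (γ 1 0 : ℂ) / denom γ w := by
      rw [E2_slash_action]
      ext z
      simp only [Pi.sub_apply, Pi.smul_apply, D2, riemannZeta_two, smul_eq_mul]
      field_simp
    have h4 := slash_eq_of_mem_SL E₄ γ
    have h8 := mul_slash_SL2 2 2 γ E2 E2
    have hD := normalizedDerivOfComplex_SL_slash (k := 2) E2_mdifferentiable (γ := γ)
    have hm := mdifferentiable_const_div_denom γ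
    rw [hE2, normalizedDerivOfComplex_sub _ _ E2_mdifferentiable (hm.const_smul _),
      normalizedDerivOfComplex_smul _ _ hm] at hD
    ext z
    have hDz := congrFun hD z
    have h8z := congrFun h8 z
    rw [hE2] at h8z
    have h4z := congrFun h4 z
    rw [sub_eq_add_neg, SlashAction.add_slash, SlashAction.neg_slash, ModularForm.SL_smul_slash,
      sub_eq_add_neg, SlashAction.add_slash, SlashAction.neg_slash]
    simp only [Pi.sub_apply, Pi.smul_apply, Pi.mul_apply, Pi.add_apply, Pi.neg_apply, smul_eq_mul,
      normalizedDerivOfComplex_const_div_denom] at hDz h8z ⊢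
    norm_num at hDz h8z h4z ⊢
    rw [h8z, h4z]
    linear_combination -hDz
  · have hD : Tendsto (normalizedDerivOfComplex E2) atImInfty (𝓝 0) :=
      tendsto_normalizedDerivOfComplex_atImInfty_of_hasSum E2_mdifferentiable hasSum_qParam_E2
    have h := hD.sub (((tendsto_E2_atImInfty.mul tendsto_E2_atImInfty).sub
      tendsto_E₄_atImInfty).const_mul (12⁻¹ : ℂ))
    norm_num at h
    refine h.congr fun z ↦ ?_
    simp

end Ramanujan

section ImaginaryAxis

open scoped Manifold

open UpperHalfPlane hiding I
open Complex Derivative EisensteinSeries ModularForm Filter Topology Function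

theorem eq_ofReal_of_hasSum_qParam {t C : ℝ} {c : ℂ} (hc : c = C) {k : ℕ} {w : ℂ}
    (h : HasSum (fun m ↦ (if m = 0 then 1 else c * (ArithmeticFunction.sigma k m : ℂ)) •
      Periodic.qParam 1 (t * I) ^ m) w) :
    w = ((1 + C * ∑' n : ℕ, (∑ d ∈ Nat.divisors (n + 1), (d : ℝ) ^ k) * nome t ^ (n + 1) : ℝ) :
      ℂ) := by
  have hq : Periodic.qParam 1 (t * I) = (nome t : ℂ) := by
    simp only [Periodic.qParam, nome, ofReal_exp]
    congr 1
    push_cast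
    linear_combination (2 * Real.pi * t : ℂ) * I_sq
  rw [← hasSum_nat_add_iff' 1] at h
  have h' := h.tsum_eq
  simp only [Finset.range_one, Finset.sum_singleton, if_true, pow_zero, Nat.succ_ne_zero, if_false,
    hq, smul_eq_mul, mul_one, mul_assoc, tsum_mul_left, ArithmeticFunction.sigma_apply] at h'
  push_cast at h' ⊢
  rw [← hc]
  linear_combination -h'

theorem coe_ofComplex_mul_I {t : ℝ} (ht : 0 < t) : (ofComplex (t * I) : ℂ) = t * I := by
  rw [ofComplex_apply_of_im_pos (by simpa using ht)]

theorem E2_ofComplex_mul_I {t : ℝ} (ht : 0 < t) : E2 (ofComplex (t * I)) = (E2val t : ℂ) := by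
  have h := hasSum_qParam_E2 (ofComplex (t * I))
  rw [coe_ofComplex_mul_I ht] at h
  rw [eq_ofReal_of_hasSum_qParam (C := -24) (by norm_num) h, E2val]
  congr 1
  ring

theorem E₄_ofComplex_mul_I {t : ℝ} (ht : 0 < t) : E₄ (ofComplex (t * I)) = (E4val t : ℂ) := by
  have h := hasSum_qParam_E₄ (ofComplex (t * I))
  rw [coe_ofComplex_mul_I ht] at h
  rw [eq_ofReal_of_hasSum_qParam (C := 240) (by norm_num) h, E4val]

theorem E₆_ofComplex_mul_I {t : ℝ} (ht : 0 < t) : E₆ (ofComplex (t * I)) = (E6val t : ℂ) := by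
  have h := hasSum_qParam_E₆ (ofComplex (t * I))
  rw [coe_ofComplex_mul_I ht] at h
  rw [eq_ofReal_of_hasSum_qParam (C := -504) (by norm_num) h, E6val]
  congr 1
  ring

theorem hasDerivAt_of_eq_ofReal_on_imaginary_axis {f : ℍ → ℂ} (hol : MDiff f) {g : ℝ → ℝ}
    (hg : ∀ t : ℝ, 0 < t → f (ofComplex (t * I)) = g t) {t d : ℝ} (ht : 0 < t)
    (hd : normalizedDerivOfComplex f (ofComplex (t * I)) = d) :
    HasDerivAt g (-2 * Real.pi * d) t := by
  have h1 := (mdifferentiableAt_iff.mp (hol (ofComplex (t * I)))).hasDerivAt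
  have h2 : deriv (f ∘ ofComplex) (ofComplex (t * I) : ℂ) = 2 * Real.pi * I * d := by
    rw [← hd, normalizedDerivOfComplex]
    field_simp [two_pi_I_ne_zero]
  rw [h2, coe_ofComplex_mul_I ht] at h1
  have h3 : HasDerivAt (fun z : ℂ ↦ z * I) I (t : ℂ) := by
    simpa using (hasDerivAt_id (t : ℂ)).mul_const I
  have h4 := (h1.comp (t : ℂ) h3).real_of_complex
  have h5 : (2 * Real.pi * I * d * I : ℂ) = ((-2 * Real.pi * d : ℝ) : ℂ) := by
    push_cast
    linear_combination (2 * Real.pi * d : ℂ) * I_sq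
  rw [h5, ofReal_re] at h4
  refine h4.congr_of_eventuallyEq ?_
  filter_upwards [lt_mem_nhds ht] with s hs
  simp [hg s hs]

theorem hasDerivAt_E2val {t : ℝ} (ht : 0 < t) :
    HasDerivAt E2val (-2 * Real.pi * ((E2val t ^ 2 - E4val t) / 12)) t :=
  hasDerivAt_of_eq_ofReal_on_imaginary_axis E2_mdifferentiable
    (fun _ ↦ E2_ofComplex_mul_I) ht (by
    rw [normalizedDerivOfComplex_E2, E2_ofComplex_mul_I ht, E₄_ofComplex_mul_I ht]
    push_cast
    rfl)

theorem hasDerivAt_E4val {t : ℝ} (ht : 0 < t) :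
    HasDerivAt E4val (-2 * Real.pi * ((E2val t * E4val t - E6val t) / 3)) t :=
  hasDerivAt_of_eq_ofReal_on_imaginary_axis E₄.holo'
    (fun _ ↦ E₄_ofComplex_mul_I) ht (by
    refine (normalizedDerivOfComplex_E₄ _).trans ?_
    rw [E2_ofComplex_mul_I ht, E₄_ofComplex_mul_I ht, E₆_ofComplex_mul_I ht]
    push_cast
    rfl)

theorem hasDerivAt_E6val {t : ℝ} (ht : 0 < t) :
    HasDerivAt E6val (-2 * Real.pi * ((E2val t * E6val t - E4val t ^ 2) / 2)) t :=
  hasDerivAt_of_eq_ofReal_on_imaginary_axis E₆.holo'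
    (fun _ ↦ E₆_ofComplex_mul_I) ht (by
    refine (normalizedDerivOfComplex_E₆ _).trans ?_
    rw [E2_ofComplex_mul_I ht, E₄_ofComplex_mul_I ht, E₆_ofComplex_mul_I ht]
    push_cast
    rfl)

theorem tendsto_atTop_of_eq_ofReal_on_imaginary_axis {f : ℍ → ℂ} {g : ℝ → ℝ} {c : ℝ}
    (hf : Tendsto f atImInfty (𝓝 c)) (hg : ∀ t : ℝ, 0 < t → f (ofComplex (t * I)) = g t) :
    Tendsto g atTop (𝓝 c) := by
  have h1 : Tendsto (fun t : ℝ ↦ ofComplex (t * I)) atTop atImInfty := by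
    rw [atImInfty, tendsto_comap_iff]
    refine tendsto_id.congr' ?_
    filter_upwards [eventually_gt_atTop 0] with t ht
    simp only [comp_apply, id_eq, ← coe_im, coe_ofComplex_mul_I ht]
    simp
  have h2 := (Complex.continuous_re.tendsto _).comp (hf.comp h1)
  rw [ofReal_re] at h2
  refine h2.congr' ?_
  filter_upwards [eventually_gt_atTop 0] with t ht
  simp [hg t ht]

theorem tendsto_E2val_atTop : Tendsto E2val atTop (𝓝 1) :=
  tendsto_atTop_of_eq_ofReal_on_imaginary_axis (mod_cast tendsto_E2_atImInfty)
    fun _ ↦ E2_ofComplex_mul_I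

theorem tendsto_E4val_atTop : Tendsto E4val atTop (𝓝 1) :=
  tendsto_atTop_of_eq_ofReal_on_imaginary_axis (mod_cast tendsto_E₄_atImInfty)
    fun _ ↦ E₄_ofComplex_mul_I

theorem tendsto_E6val_atTop : Tendsto E6val atTop (𝓝 1) :=
  tendsto_atTop_of_eq_ofReal_on_imaginary_axis (mod_cast tendsto_E₆_atImInfty)
    fun _ ↦ E₆_ofComplex_mul_I

theorem tsum_divisors_mul_nome_nonneg (k : ℕ) (t : ℝ) :
    0 ≤ ∑' n : ℕ, (∑ d ∈ Nat.divisors (n + 1), (d : ℝ) ^ k) * nome t ^ (n + 1) := by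
  have := (Real.exp_pos (-2 * Real.pi * t)).le
  exact tsum_nonneg fun n ↦ mul_nonneg (by positivity) (pow_nonneg this _)

theorem one_le_E4val (t : ℝ) : 1 ≤ E4val t := by
  have := tsum_divisors_mul_nome_nonneg 3 t
  rw [E4val]
  linarith

theorem E6val_le_one (t : ℝ) : E6val t ≤ 1 := by
  have := tsum_divisors_mul_nome_nonneg 5 t
  rw [E6val]
  linarith

theorem E6val_sq_lt_E4val_cube {t : ℝ} (ht : 0 < t) : E6val t ^ 2 < E4val t ^ 3 := by
  have hne : ∀ s : ℝ, 0 < s → E4val s ^ 3 - E6val s ^ 2 ≠ 0 := by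
    intro s hs h
    have h1 := discriminant_eq_E₄_cube_sub_E₆_sq (ofComplex (s * I))
    rw [E₄_ofComplex_mul_I hs, E₆_ofComplex_mul_I hs] at h1
    refine discriminant_ne_zero _ (h1.trans ?_)
    rw_mod_cast [h]
    simp
  obtain ⟨T, hT6, hTt⟩ := ((tendsto_E6val_atTop.eventually (lt_mem_nhds one_pos)).and
    (eventually_gt_atTop t)).exists
  have hTpos : 0 < E4val T ^ 3 - E6val T ^ 2 := by
    refine lt_of_le_of_ne ?_ (hne T (ht.trans hTt)).symm
    have h3 := one_le_pow₀ (one_le_E4val T) (n := 3)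
    have h2 := pow_le_one₀ hT6.le (E6val_le_one T) (n := 2)
    linarith
  by_contra! hcon
  have hcont : ContinuousOn (fun s ↦ E4val s ^ 3 - E6val s ^ 2) (Set.Icc t T) := fun s hs ↦
    (((hasDerivAt_E4val (ht.trans_le hs.1)).continuousAt.pow 3).sub
      ((hasDerivAt_E6val (ht.trans_le hs.1)).continuousAt.pow 2)).continuousWithinAt
  obtain ⟨s, hs, hs0⟩ := intermediate_value_Icc hTt.le hcont
    (show (0 : ℝ) ∈ _ from ⟨by linarith, hTpos.le⟩)
  exact hne s (ht.trans_le hs.1) hs0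

end ImaginaryAxis

section Hypergeometric

open Filter Topology

theorem summable_mul_pow_of_abs_le {a : ℕ → ℝ} {C : ℝ} {p : ℕ} (ha : ∀ k, |a k| ≤ C * (k + 1) ^ p)
    {x : ℝ} (hx : |x| < 1) : Summable fun k ↦ a k * x ^ k := by
  have hC : 0 ≤ C := by simpa using (abs_nonneg _).trans (ha 0)
  have h1 := (summable_pow_mul_geometric_of_norm_lt_one p
    (show ‖|x|‖ < 1 by simpa using hx)).mul_left (C * 2 ^ p)
  refine .of_norm_bounded_eventually_nat h1 ?_
  filter_upwards [eventually_ge_atTop 1] with k hk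
  have hk' : (1 : ℝ) ≤ k := mod_cast hk
  rw [norm_mul, norm_pow, Real.norm_eq_abs, Real.norm_eq_abs, ← mul_assoc, mul_assoc C, ← mul_pow]
  refine mul_le_mul_of_nonneg_right ((ha k).trans ?_) (by positivity)
  gcongr
  linarith

theorem hasDerivAt_tsum_mul_pow {a : ℕ → ℝ} {C : ℝ} {p : ℕ} (ha : ∀ k, |a k| ≤ C * (k + 1) ^ p)
    {x : ℝ} (hx : |x| < 1) :
    HasDerivAt (fun y ↦ ∑' k, a k * y ^ k) (∑' k, (k + 1) * a (k + 1) * x ^ k) x := by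
  have hC : 0 ≤ C := by simpa using (abs_nonneg _).trans (ha 0)
  have hbd : ∀ k : ℕ, |((k : ℝ) + 1) * abs (a (k + 1))| ≤ C * 2 ^ p * (k + 1) ^ (p + 1) := by
    intro k
    rw [abs_of_nonneg (by positivity)]
    have h1 := ha (k + 1)
    have h2 : ((k + 1 : ℕ) + 1 : ℝ) ^ p ≤ (2 * (k + 1)) ^ p := by
      gcongr
      push_cast
      linarith [Nat.cast_nonneg (α := ℝ) k]
    calc (k + 1) * |a (k + 1)| ≤ (k + 1) * (C * (2 * (k + 1)) ^ p) := by
          gcongr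
          exact h1.trans (by gcongr)
      _ = C * 2 ^ p * (k + 1) ^ (p + 1) := by rw [mul_pow]; ring
  obtain ⟨r, hxr, hr1⟩ := exists_between hx
  have hr0 : 0 ≤ r := (abs_nonneg x).trans hxr.le
  have hu : Summable fun k : ℕ ↦ (k : ℝ) * |a k| * r ^ (k - 1) := by
    rw [← summable_nat_add_iff 1]
    simpa using summable_mul_pow_of_abs_le hbd (show |r| < 1 by rwa [abs_of_nonneg hr0])
  have h := hasDerivAt_tsum_of_isPreconnected (g := fun k y ↦ a k * y ^ k)
    (g' := fun k y ↦ a k * (k * y ^ (k - 1))) (t := Set.Ioo (-r) r) (y₀ := x) hu isOpen_Ioo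
    isPreconnected_Ioo (fun k y _ ↦ (hasDerivAt_pow k y).const_mul (a k)) (fun k y hy ↦ ?_)
    (abs_lt.mp hxr) (summable_mul_pow_of_abs_le ha hx) (abs_lt.mp hxr)
  · refine h.congr_deriv ?_
    have hs : Summable fun k : ℕ ↦ a k * (k * x ^ (k - 1)) := by
      refine .of_norm_bounded hu fun k ↦ ?_
      rw [norm_mul, norm_mul, norm_pow, Real.norm_eq_abs, Real.norm_eq_abs, Real.norm_eq_abs,
        Nat.abs_cast, ← mul_assoc, mul_comm |a k|]
      gcongr
    rw [hs.tsum_eq_zero_add]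
    simp only [Nat.cast_zero, zero_mul, mul_zero, zero_add, Nat.cast_add, Nat.cast_one,
      Nat.add_sub_cancel]
    exact tsum_congr fun k ↦ by ring
  · rw [norm_mul, norm_mul, norm_pow, Real.norm_eq_abs, Real.norm_eq_abs, Real.norm_eq_abs,
      Nat.abs_cast, ← mul_assoc, mul_comm |a k|]
    gcongr
    exact (abs_lt.mpr hy).le

/-- The coefficients of the Gauss hypergeometric series `₂F₁(1/6, 5/6; 1; x)`. -/
noncomputable def gaussCoeff (k : ℕ) : ℝ :=
  (ascPochhammer ℝ k).eval (1 / 6) * (ascPochhammer ℝ k).eval (5 / 6) / (k.factorial : ℝ) ^ 2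

theorem gaussCoeff_succ (k : ℕ) :
    (k + 1) ^ 2 * gaussCoeff (k + 1) = (k + 1 / 6) * (k + 5 / 6) * gaussCoeff k := by
  have : (k.factorial : ℝ) ≠ 0 := mod_cast k.factorial_ne_zero
  rw [gaussCoeff, gaussCoeff, ascPochhammer_succ_eval, ascPochhammer_succ_eval, Nat.factorial_succ]
  push_cast
  field_simp
  ring

theorem gaussCoeff_nonneg (k : ℕ) : 0 ≤ gaussCoeff k := by
  have h1 := (ascPochhammer_pos k (1 / 6 : ℝ) (by norm_num)).le
  have h2 := (ascPochhammer_pos k (5 / 6 : ℝ) (by norm_num)).le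
  rw [gaussCoeff]
  positivity

theorem gaussCoeff_le_one (k : ℕ) : gaussCoeff k ≤ 1 := by
  induction k with
  | zero => simp [gaussCoeff]
  | succ k ih =>
    have h := gaussCoeff_succ k
    have hk : (0 : ℝ) ≤ k := k.cast_nonneg
    have h0 := gaussCoeff_nonneg k
    have : (k + 1 : ℝ) ^ 2 * gaussCoeff (k + 1) ≤ (k + 1) ^ 2 * 1 := by
      rw [h]
      gcongr
      nlinarith
    exact le_of_mul_le_mul_left this (by positivity)

theorem abs_gaussCoeff_le (k : ℕ) : |gaussCoeff k| ≤ 1 * (k + 1) ^ 0 := by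
  rw [abs_of_nonneg (gaussCoeff_nonneg k)]
  simpa using gaussCoeff_le_one k

theorem hasDerivAt_gauss2F1 {x : ℝ} (hx : |x| < 1) :
    HasDerivAt (gauss2F1 (1 / 6) (5 / 6)) (∑' k : ℕ, (k + 1) * gaussCoeff (k + 1) * x ^ k) x :=
  hasDerivAt_tsum_mul_pow abs_gaussCoeff_le hx

theorem gauss2F1_zero : gauss2F1 (1 / 6) (5 / 6) 0 = 1 := by
  rw [gauss2F1, tsum_eq_single 0 (fun k hk ↦ by simp [hk])]
  simp

theorem mul_one_sub_mul_deriv_gauss2F1 {x : ℝ} (hx : |x| < 1) :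
    x * (1 - x) * deriv (gauss2F1 (1 / 6) (5 / 6)) x =
      ∑' k : ℕ, (if k = 0 then 0 else 5 / 36 * gaussCoeff (k - 1) / k) * x ^ k := by
  rw [(hasDerivAt_gauss2F1 hx).deriv]
  have hs : Summable fun k : ℕ ↦ (k + 1) * gaussCoeff (k + 1) * x ^ k := by
    refine summable_mul_pow_of_abs_le (C := 1) (p := 1) (fun k ↦ ?_) hx
    rw [abs_of_nonneg (mul_nonneg (by positivity) (gaussCoeff_nonneg _))]
    nlinarith [gaussCoeff_le_one (k + 1), Nat.cast_nonneg (α := ℝ) k]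
  have h1 : HasSum (fun k : ℕ ↦ k * gaussCoeff k * x ^ k)
      (x * ∑' k : ℕ, (k + 1) * gaussCoeff (k + 1) * x ^ k) := by
    rw [← hasSum_nat_add_iff' 1]
    simpa [pow_succ, mul_assoc, mul_comm, mul_left_comm] using hs.hasSum.mul_left x
  have h2 := (hs.hasSum.sub h1).mul_left x
  rw [eq_comm]
  refine (HasSum.tsum_eq (a := x * ((∑' k : ℕ, (k + 1) * gaussCoeff (k + 1) * x ^ k) -
    x * ∑' k : ℕ, (k + 1) * gaussCoeff (k + 1) * x ^ k)) ?_).trans (by ring)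
  rw [← hasSum_nat_add_iff' 1]
  simp only [Finset.range_one, Finset.sum_singleton, if_true, zero_mul, sub_zero]
  refine h2.congr_fun fun k ↦ ?_
  have hk : (k + 1 : ℝ) ≠ 0 := by positivity
  simp only [Nat.succ_ne_zero, if_false, Nat.add_sub_cancel]
  push_cast
  field_simp
  linear_combination (-36 * x * x ^ k) * gaussCoeff_succ k

theorem hasDerivAt_mul_one_sub_mul_deriv_gauss2F1 {x : ℝ} (hx : |x| < 1) :
    HasDerivAt (fun y ↦ y * (1 - y) * deriv (gauss2F1 (1 / 6) (5 / 6)) y)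
      (5 / 36 * gauss2F1 (1 / 6) (5 / 6) x) x := by
  have hb : ∀ k : ℕ, |if k = 0 then 0 else 5 / 36 * gaussCoeff (k - 1) / k| ≤
      1 * ((k : ℝ) + 1) ^ 0 := by
    intro k
    rcases k with _ | k
    · simp
    · have h0 := gaussCoeff_nonneg k
      have h1 := gaussCoeff_le_one k
      simp only [Nat.succ_ne_zero, if_false, Nat.add_sub_cancel, pow_zero, mul_one]
      rw [abs_of_nonneg (by positivity), div_le_one (by positivity)]
      push_cast
      linarith [Nat.cast_nonneg (α := ℝ) k]
  have h := hasDerivAt_tsum_mul_pow hb hx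
  have hev : (fun y ↦ y * (1 - y) * deriv (gauss2F1 (1 / 6) (5 / 6)) y) =ᶠ[𝓝 x]
      fun y ↦ ∑' k : ℕ, (if k = 0 then 0 else 5 / 36 * gaussCoeff (k - 1) / k) * y ^ k := by
    filter_upwards [continuous_abs.continuousAt.eventually (gt_mem_nhds hx)] with y hy
    exact mul_one_sub_mul_deriv_gauss2F1 hy
  refine (h.congr_of_eventuallyEq hev).congr_deriv ?_
  change _ = 5 / 36 * ∑' k, gaussCoeff k * x ^ k
  rw [← tsum_mul_left]
  refine tsum_congr fun k ↦ ?_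
  have hk : (k + 1 : ℝ) ≠ 0 := by positivity
  simp only [Nat.succ_ne_zero, if_false, Nat.add_sub_cancel]
  push_cast
  field_simp

end Hypergeometric

section GaussEisenstein

open Filter Topology

theorem eq_of_hasDerivAt_zero_of_tendsto_atTop {W : ℝ → ℝ} {L : ℝ}
    (hW : ∀ t, 0 < t → HasDerivAt W 0 t) (hL : Tendsto W atTop (𝓝 L)) {t : ℝ} (ht : 0 < t) :
    W t = L := by
  refine tendsto_nhds_unique (tendsto_const_nhds.congr' ?_) hL
  filter_upwards [eventually_ge_atTop t] with s hs
  exact (constant_of_has_deriv_right_zero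
    (fun r hr ↦ (hW r (ht.trans_le hr.1)).continuousAt.continuousWithinAt)
    (fun r hr ↦ (hW r (ht.trans_le hr.1)).hasDerivWithinAt) s ⟨hs, le_rfl⟩).symm

theorem E4val_pos (t : ℝ) : 0 < E4val t := one_pos.trans_le (one_le_E4val t)

theorem E4val_rpow_quarter_pow_four (t : ℝ) : (E4val t ^ ((1 : ℝ) / 4)) ^ 4 = E4val t := by
  rw [← Real.rpow_natCast, ← Real.rpow_mul (E4val_pos t).le]
  norm_num

theorem E4val_rpow_three_halves (t : ℝ) :
    E4val t ^ ((3 : ℝ) / 2) = (E4val t ^ ((1 : ℝ) / 4)) ^ 6 := by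
  rw [← Real.rpow_natCast, ← Real.rpow_mul (E4val_pos t).le]
  norm_num

theorem xval_eq (t : ℝ) : xval t = 1 / 2 * (1 - E6val t / (E4val t ^ ((1 : ℝ) / 4)) ^ 6) := by
  rw [xval, E4val_rpow_three_halves]

theorem abs_E6val_lt {t : ℝ} (ht : 0 < t) : |E6val t| < (E4val t ^ ((1 : ℝ) / 4)) ^ 6 := by
  have hg : 0 < E4val t ^ ((1 : ℝ) / 4) := Real.rpow_pos_of_pos (E4val_pos t) _
  refine abs_lt_of_sq_lt_sq ?_ (by positivity)
  have h := E6val_sq_lt_E4val_cube ht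
  rw [← E4val_rpow_quarter_pow_four t] at h
  linarith

theorem abs_xval_lt_one {t : ℝ} (ht : 0 < t) : |xval t| < 1 := by
  have hg : 0 < E4val t ^ ((1 : ℝ) / 4) := Real.rpow_pos_of_pos (E4val_pos t) _
  have h : |E6val t / (E4val t ^ ((1 : ℝ) / 4)) ^ 6| < 1 := by
    rw [abs_div, abs_of_pos (a := (E4val t ^ ((1 : ℝ) / 4)) ^ 6) (by positivity),
      div_lt_one (by positivity)]
    exact abs_E6val_lt ht
  rw [xval_eq, abs_lt]
  rw [abs_lt] at h
  constructor <;> linarith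

theorem hasDerivAt_E4val_rpow_quarter {t : ℝ} (ht : 0 < t) :
    HasDerivAt (fun s ↦ E4val s ^ ((1 : ℝ) / 4))
      (-2 * Real.pi * ((E2val t * (E4val t ^ ((1 : ℝ) / 4)) ^ 4 - E6val t) /
        (12 * (E4val t ^ ((1 : ℝ) / 4)) ^ 3))) t := by
  have hg : 0 < E4val t ^ ((1 : ℝ) / 4) := Real.rpow_pos_of_pos (E4val_pos t) _
  refine ((hasDerivAt_E4val ht).rpow_const (p := (1 : ℝ) / 4)
    (Or.inl (E4val_pos t).ne')).congr_deriv ?_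
  rw [Real.rpow_sub_one (E4val_pos t).ne', E4val_rpow_quarter_pow_four]
  have h4 := E4val_rpow_quarter_pow_four t
  have hQ := E4val_pos t
  field_simp
  linear_combination (-12 : ℝ) * (E2val t * E4val t - E6val t) * h4

theorem hasDerivAt_xval {t : ℝ} (ht : 0 < t) :
    HasDerivAt xval (-2 * Real.pi * ((E4val t ^ ((1 : ℝ) / 4)) ^ 2 * (xval t * (1 - xval t)))) t := by
  have hg : 0 < E4val t ^ ((1 : ℝ) / 4) := Real.rpow_pos_of_pos (E4val_pos t) _
  have h := (((hasDerivAt_E6val ht).fun_div ((hasDerivAt_E4val_rpow_quarter ht).fun_pow 6)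
    (by positivity)).const_sub 1).const_mul (1 / 2)
  refine (h.congr_of_eventuallyEq (.of_forall xval_eq)).congr_deriv ?_
  rw [xval_eq]
  have h4 := E4val_rpow_quarter_pow_four t
  set g := E4val t ^ ((1 : ℝ) / 4)
  rw [← h4]
  field_simp
  ring

/-- The normalized derivative of `-E4(it)^{-1/4}`. -/
noncomputable def derivNegInvQuarterPower (t : ℝ) : ℝ :=
  (E2val t * E4val t - E6val t) / (12 * (E4val t ^ ((1 : ℝ) / 4)) ^ 5)

theorem hasDerivAt_derivNegInvQuarterPower {t : ℝ} (ht : 0 < t) :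
    HasDerivAt derivNegInvQuarterPower
      (-2 * Real.pi * (5 / 36 * (E4val t ^ ((1 : ℝ) / 4)) ^ 3 * (xval t * (1 - xval t)))) t := by
  have hg : 0 < E4val t ^ ((1 : ℝ) / 4) := Real.rpow_pos_of_pos (E4val_pos t) _
  have h := (((hasDerivAt_E2val ht).fun_mul (hasDerivAt_E4val ht)).fun_sub
    (hasDerivAt_E6val ht)).fun_div
    (((hasDerivAt_E4val_rpow_quarter ht).fun_pow 5).const_mul 12) (by positivity)
  refine h.congr_deriv ?_
  have h4 := E4val_rpow_quarter_pow_four t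
  rw [xval_eq]
  set g := E4val t ^ ((1 : ℝ) / 4)
  rw [← h4]
  field_simp
  ring

theorem tendsto_E4val_rpow_quarter : Tendsto (fun t ↦ E4val t ^ ((1 : ℝ) / 4)) atTop (𝓝 1) := by
  simpa using tendsto_E4val_atTop.rpow_const (p := (1 : ℝ) / 4) (Or.inl one_ne_zero)

theorem tendsto_xval_atTop : Tendsto xval atTop (𝓝 0) := by
  have h := ((tendsto_E6val_atTop.div (tendsto_E4val_rpow_quarter.pow 6)
    (by norm_num)).const_sub 1).const_mul (1 / 2)
  norm_num at h
  refine h.congr fun t ↦ ?_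
  simp [xval_eq]

theorem tendsto_derivNegInvQuarterPower_atTop : Tendsto derivNegInvQuarterPower atTop (𝓝 0) := by
  have h := ((tendsto_E2val_atTop.mul tendsto_E4val_atTop).sub tendsto_E6val_atTop).div
    ((tendsto_E4val_rpow_quarter.pow 5).const_mul 12) (by norm_num)
  rw [one_mul, sub_self, zero_div] at h
  exact h

theorem tendsto_gauss2F1_xval_atTop :
    Tendsto (fun t ↦ gauss2F1 (1 / 6) (5 / 6) (xval t)) atTop (𝓝 1) := by
  have h := (hasDerivAt_gauss2F1 (x := 0) (by simp)).continuousAt.tendsto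
  rw [gauss2F1_zero] at h
  exact h.comp tendsto_xval_atTop

theorem hasDerivAt_gauss2F1_xval {t : ℝ} (ht : 0 < t) :
    HasDerivAt (fun s ↦ gauss2F1 (1 / 6) (5 / 6) (xval s))
      (-2 * Real.pi * ((E4val t ^ ((1 : ℝ) / 4)) ^ 2 *
        (xval t * (1 - xval t) * deriv (gauss2F1 (1 / 6) (5 / 6)) (xval t)))) t := by
  have h := (hasDerivAt_gauss2F1 (abs_xval_lt_one ht)).differentiableAt.hasDerivAt
  refine (h.comp t (hasDerivAt_xval ht)).congr_deriv ?_
  ring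

theorem gauss2F1_xval_mul_derivNegInvQuarterPower {t : ℝ} (ht : 0 < t) :
    gauss2F1 (1 / 6) (5 / 6) (xval t) * derivNegInvQuarterPower t = E4val t ^ ((1 : ℝ) / 4) *
      (xval t * (1 - xval t) * deriv (gauss2F1 (1 / 6) (5 / 6)) (xval t)) := by
  have hy : Tendsto
      (fun s ↦ xval s * (1 - xval s) * deriv (gauss2F1 (1 / 6) (5 / 6)) (xval s)) atTop (𝓝 0) := by
    have h := (hasDerivAt_mul_one_sub_mul_deriv_gauss2F1 (x := 0) (by simp)).continuousAt.tendsto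
    simp only [zero_mul] at h
    exact h.comp tendsto_xval_atTop
  have hlim := (tendsto_gauss2F1_xval_atTop.mul tendsto_derivNegInvQuarterPower_atTop).sub
    (tendsto_E4val_rpow_quarter.mul hy)
  simp only [mul_zero, sub_zero] at hlim
  refine sub_eq_zero.mp (eq_of_hasDerivAt_zero_of_tendsto_atTop (fun s hs ↦ ?_) hlim ht)
  have hg : 0 < E4val s ^ ((1 : ℝ) / 4) := Real.rpow_pos_of_pos (E4val_pos s) _
  have h1 := (hasDerivAt_mul_one_sub_mul_deriv_gauss2F1 (abs_xval_lt_one hs)).comp s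
    (hasDerivAt_xval hs)
  refine (((hasDerivAt_gauss2F1_xval hs).mul (hasDerivAt_derivNegInvQuarterPower hs)).sub
    ((hasDerivAt_E4val_rpow_quarter hs).mul h1)).congr_deriv ?_
  rw [derivNegInvQuarterPower, E4val_rpow_quarter_pow_four]
  simp only [Function.comp_apply]
  field_simp
  ring

/-- Fricke's identity `₂F₁(1/6, 5/6; 1; x(t)) = E4(it)^{1/4}`. -/
theorem gauss2F1_xval {t : ℝ} (ht : 0 < t) :
    gauss2F1 (1 / 6) (5 / 6) (xval t) = E4val t ^ ((1 : ℝ) / 4) := by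
  have hg : ∀ s, 0 < E4val s ^ ((1 : ℝ) / 4) := fun s ↦ Real.rpow_pos_of_pos (E4val_pos s) _
  have hlim := tendsto_gauss2F1_xval_atTop.div tendsto_E4val_rpow_quarter one_ne_zero
  rw [div_one] at hlim
  refine (div_eq_one_iff_eq (hg t).ne').mp
    (eq_of_hasDerivAt_zero_of_tendsto_atTop (fun s hs ↦ ?_) hlim ht)
  refine ((hasDerivAt_gauss2F1_xval hs).div (hasDerivAt_E4val_rpow_quarter hs)
    (hg s).ne').congr_deriv ?_
  have hW := gauss2F1_xval_mul_derivNegInvQuarterPower hs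
  rw [derivNegInvQuarterPower] at hW
  rw [E4val_rpow_quarter_pow_four]
  have hgs := hg s
  rw [div_eq_zero_iff]
  left
  field_simp at hW ⊢
  linear_combination 2 * Real.pi * hW

theorem xval_mul_deriv_gauss2F1_xval {t : ℝ} (ht : 0 < t) :
    xval t * deriv (gauss2F1 (1 / 6) (5 / 6)) (xval t)
      = E4val t ^ ((1 : ℝ) / 4) * (E2val t * E4val t - E6val t) /
          (6 * (E4val t ^ ((3 : ℝ) / 2) + E6val t)) := by
  have hg : 0 < E4val t ^ ((1 : ℝ) / 4) := Real.rpow_pos_of_pos (E4val_pos t) _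
  have hW := gauss2F1_xval_mul_derivNegInvQuarterPower ht
  rw [gauss2F1_xval ht] at hW
  have hv := mul_left_cancel₀ hg.ne' hW
  have hne : 0 < (E4val t ^ ((1 : ℝ) / 4)) ^ 6 + E6val t := by
    linarith [(abs_lt.mp (abs_E6val_lt ht)).1]
  have hx : 1 - xval t = ((E4val t ^ ((1 : ℝ) / 4)) ^ 6 + E6val t) /
      (2 * (E4val t ^ ((1 : ℝ) / 4)) ^ 6) := by
    rw [xval_eq]
    field_simp
    ring
  rw [derivNegInvQuarterPower, hx] at hv
  rw [E4val_rpow_three_halves, eq_div_iff (by positivity)]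
  field_simp at hv
  linear_combination -(1 / 2) * hv

end GaussEisenstein

/-- For `t ≥ 1`:
`x(t)·₂F₁'(1/6, 5/6; 1; x(t)) = E4^{1/4}(E2·E4 − E6)/(6(E4^{3/2} + E6))` at `τ = it`. -/
theorem statement18 :
    ∀ t : ℝ, 1 ≤ t →
      xval t * deriv (gauss2F1 (1 / 6) (5 / 6)) (xval t)
        = E4val t ^ ((1 : ℝ) / 4) * (E2val t * E4val t - E6val t) /
            (6 * (E4val t ^ ((3 : ℝ) / 2) + E6val t)) := by
  intro t ht
  exact xval_mul_deriv_gauss2F1_xval (one_pos.trans_le ht)
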